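/- There exists a constant C > 0, independent of Φ, α, n and f, such that for every Φ ≥ 0, every α ≥ 0, every integer n, every admissible right-hand side f, and every smooth solution ψ of the n-th mode problem with Navier boundary conditions, one has (Φ·|n|)²·∫₀¹ |ψ(r)|²·r dr ≤ C·∫₀¹ |f(r)|²·r dr and ∫₀¹ |(𝓛ψ)(r)|²·r dr + n²·∫₀¹ |(d/dr)(r·ψ(r))|²·(1/r) dr + n⁴·∫₀¹ |ψ(r)|²·r dr ≤ C·∫₀¹ |f(r)|²·r dr. (Lemma B.1, a priori estimates of the stream function in terms of f.) -/

import Mathlib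

open MeasureTheory Filter

/-- One-sided derivative on `(0,1]`. -/
noncomputable def dz (g : ℝ → ℂ) : ℝ → ℂ := derivWithin g (Set.Ioc 0 1)

/-- The operator `(𝓛 g)(r) = g''(r) + (1/r) g'(r) − (1/r²) g(r)`. -/
noncomputable def Lop (g : ℝ → ℂ) : ℝ → ℂ := fun r =>
  dz (dz g) r + ((r : ℂ))⁻¹ * dz g r - (((r : ℂ)) ^ 2)⁻¹ * g r

/-- Weighted integral over `(0,1)` with values in `[0,∞]`. -/
noncomputable def wInt (h : ℝ → ℝ) : ENNReal :=
  ∫⁻ r in Set.Ioo (0 : ℝ) 1, ENNReal.ofReal (h r)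

/-- The Poiseuille profile `Ū(r) = ((4+2α)/(4+α)) (1 − (2α/(4+2α)) r²) (Φ/π)`. -/
noncomputable def Ubar (Φ α : ℝ) : ℝ → ℝ := fun r =>
  (4 + 2 * α) / (4 + α) * (1 - 2 * α / (4 + 2 * α) * r ^ 2) * (Φ / Real.pi)

/-- A smooth solution of the `n`-th mode problem with Navier boundary conditions:
`ψ` is four times continuously differentiable on `(0,1]`; `ψ`, `ψ'`, `𝓛ψ` and
`(d/dr)(r 𝓛ψ)` extend continuously to `[0,1]`;
`i n Ū (𝓛−n²)ψ − (𝓛−n²)²ψ = f` on `(0,1)`; `ψ(0) = ψ(1) = (𝓛ψ)(0) = 0` and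
`(𝓛ψ)(1) = −α ψ'(1)`; and the relevant weighted integrals are finite. -/
structure NavierSol (Φ α : ℝ) (n : ℤ) (f ψ : ℝ → ℂ) : Prop where
  smooth : ContDiffOn ℝ 4 ψ (Set.Ioc 0 1)
  /-- `ψ` extends continuously to `[0,1]` with `ψ(0) = 0`. -/
  ext_psi : Filter.Tendsto ψ (nhdsWithin (0 : ℝ) (Set.Ioc 0 1)) (nhds (0 : ℂ))
  /-- `ψ'` extends continuously to `[0,1]`. -/
  ext_dpsi : ∃ L : ℂ, Filter.Tendsto (dz ψ) (nhdsWithin (0 : ℝ) (Set.Ioc 0 1)) (nhds L)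
  /-- `𝓛ψ` extends continuously to `[0,1]` with `(𝓛ψ)(0) = 0`. -/
  ext_Lpsi : Filter.Tendsto (Lop ψ) (nhdsWithin (0 : ℝ) (Set.Ioc 0 1)) (nhds (0 : ℂ))
  /-- `(d/dr)(r 𝓛ψ)` extends continuously to `[0,1]`. -/
  ext_dLpsi : ∃ L : ℂ, Filter.Tendsto (dz (fun r => (r : ℂ) * Lop ψ r))
    (nhdsWithin (0 : ℝ) (Set.Ioc 0 1)) (nhds L)
  bc_psi : ψ 1 = 0
  bc_navier : Lop ψ 1 = -(α : ℂ) * dz ψ 1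
  eqn : ∀ r ∈ Set.Ioo (0 : ℝ) 1,
    Complex.I * (n : ℂ) * (Ubar Φ α r : ℂ) * (Lop ψ r - (n : ℂ) ^ 2 * ψ r)
      - (Lop (fun s => Lop ψ s - (n : ℂ) ^ 2 * ψ s) r
          - (n : ℂ) ^ 2 * (Lop ψ r - (n : ℂ) ^ 2 * ψ r)) = f r
  fin_psi : wInt (fun r => ‖ψ r‖ ^ 2 * r) < ⊤
  fin_dpsi : wInt (fun r => ‖dz (fun s => (s : ℂ) * ψ s) r‖ ^ 2 / r) < ⊤
  fin_Lpsi : wInt (fun r => ‖Lop ψ r‖ ^ 2 * r) < ⊤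
  fin_dLpsi : wInt (fun r => ‖dz (fun s => (s : ℂ) * Lop ψ s) r‖ ^ 2 / r) < ⊤
  fin_LLpsi : wInt (fun r => ‖Lop (Lop ψ) r‖ ^ 2 * r) < ⊤


lemma ftc_aux (T T' : ℝ → ℝ) (T1 : ℝ) (hd : ∀ r ∈ Set.Ioo (0:ℝ) 1, HasDerivAt T (T' r) r)
    (hi : IntegrableOn T' (Set.Ioo 0 1))
    (h0 : Tendsto T (nhdsWithin 0 (Set.Ioi 0)) (nhds 0))
    (h1 : Tendsto T (nhdsWithin 1 (Set.Iio 1)) (nhds T1)) :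
    ∫ r in Set.Ioo (0:ℝ) 1, T' r = T1 := by
  have hii : IntervalIntegrable T' volume 0 1 := by
    rw [intervalIntegrable_iff_integrableOn_Ioo_of_le zero_le_one]; exact hi
  have := intervalIntegral.integral_eq_sub_of_hasDerivAt_of_tendsto zero_lt_one hd hii h0 h1
  rw [intervalIntegral.integral_of_le zero_le_one, integral_Ioc_eq_integral_Ioo] at this
  simpa using this

lemma ftc_le_aux (T T' φ : ℝ → ℝ) (hd : ∀ r ∈ Set.Ioo (0:ℝ) 1, HasDerivAt T (T' r) r)
    (hi : IntegrableOn φ (Set.Ioo 0 1)) (hle : ∀ r ∈ Set.Ioo (0:ℝ) 1, T' r ≤ φ r)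
    (h0 : Tendsto T (nhdsWithin 0 (Set.Ioi 0)) (nhds 0))
    (h1 : Tendsto T (nhdsWithin 1 (Set.Iio 1)) (nhds 0)) :
    0 ≤ ∫ r in Set.Ioo (0:ℝ) 1, φ r := by
  have hc : ContinuousOn T (Set.Ioo 0 1) := fun r hr => (hd r hr).continuousAt.continuousWithinAt
  have e0 := eq_lim_at_left_extendFrom_Ioo (f := T) (zero_lt_one (α := ℝ)) h0
  have e1 := eq_lim_at_right_extendFrom_Ioo (f := T) (zero_lt_one (α := ℝ)) h1
  have hce := continuousOn_Icc_extendFrom_Ioo (f := T) hc h0 h1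
  have hi' : IntegrableOn φ (Set.Icc 0 1) := by rwa [integrableOn_Icc_iff_integrableOn_Ioo]
  have := intervalIntegral.sub_le_integral_of_hasDeriv_right_of_le (g' := T') zero_le_one hce ?_ hi' hle
  · rw [e0, e1, intervalIntegral.integral_of_le zero_le_one, integral_Ioc_eq_integral_Ioo] at this
    simpa using this
  · intro x hx
    refine HasDerivAt.hasDerivWithinAt ((hd x hx).congr_of_eventuallyEq ?_)
    filter_upwards [isOpen_Ioo.mem_nhds hx] with y hy
    exact extendFrom_eq (subset_closure hy) (hc y hy)

/-- Integrability together with the value of the integral. -/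
def HI (f : ℝ → ℝ) (a : ℝ) : Prop :=
  IntegrableOn f (Set.Ioo 0 1) ∧ ∫ r in Set.Ioo (0:ℝ) 1, f r = a

lemma HI.add {f g : ℝ → ℝ} {a b : ℝ} (hf : HI f a) (hg : HI g b) : HI (fun r => f r + g r) (a + b) :=
  ⟨Integrable.add hf.1 hg.1, by rw [integral_add hf.1 hg.1, hf.2, hg.2]⟩

lemma HI.sub {f g : ℝ → ℝ} {a b : ℝ} (hf : HI f a) (hg : HI g b) : HI (fun r => f r - g r) (a - b) :=
  ⟨Integrable.sub hf.1 hg.1, by rw [integral_sub hf.1 hg.1, hf.2, hg.2]⟩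

lemma HI.cmul {f : ℝ → ℝ} {a : ℝ} (hf : HI f a) (c : ℝ) : HI (fun r => c * f r) (c * a) :=
  ⟨Integrable.const_mul hf.1 c, by rw [integral_const_mul, hf.2]⟩

lemma HI.mono {f g : ℝ → ℝ} {a b : ℝ} (hf : HI f a) (hg : HI g b)
    (h : ∀ r ∈ Set.Ioo (0:ℝ) 1, f r ≤ g r) : a ≤ b := by
  rw [← hf.2, ← hg.2]
  exact setIntegral_mono_on hf.1 hg.1 measurableSet_Ioo h

lemma int_aux (h p q : ℝ → ℝ) (M : ℝ) (hc : ContinuousOn h (Set.Ioo 0 1))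
    (hp : IntegrableOn p (Set.Ioo 0 1)) (hq : IntegrableOn q (Set.Ioo 0 1))
    (hb : ∀ r ∈ Set.Ioo (0:ℝ) 1, |h r| ≤ M * (p r + q r)) :
    IntegrableOn h (Set.Ioo 0 1) := by
  refine Integrable.mono' ((hp.add hq).const_mul M) (hc.aestronglyMeasurable measurableSet_Ioo) ?_
  filter_upwards [ae_restrict_mem measurableSet_Ioo] with r hr
  exact hb r hr

lemma mul_bd (x y r : ℝ) (hr : 0 < r) : |r * (x * y)| ≤ 1 * (x ^ 2 * r + y ^ 2 * r) := by
  rw [abs_le]; constructor <;> nlinarith [mul_nonneg hr.le (sq_nonneg (x + y)),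
    mul_nonneg hr.le (sq_nonneg (x - y)), mul_nonneg hr.le (sq_nonneg x), mul_nonneg hr.le (sq_nonneg y)]

set_option maxHeartbeats 4000000 in
lemma core (u v gu gv lu lv hu hv ku kv fu fv U : ℝ → ℝ) (n c k m α gu1 gv1 hu1 hv1 hu0 hv0 : ℝ)
    (hα : 0 ≤ α) (hm : 0 ≤ m) (hk : 0 ≤ k) (hkm : k ≤ 4 * m)
    (hU : ∀ r, U r = c - k / 2 * r ^ 2)
    (hUm : ∀ r ∈ Set.Ioo (0:ℝ) 1, m * (1 - r ^ 2) ≤ U r)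
    (du : ∀ r ∈ Set.Ioo (0:ℝ) 1, HasDerivAt u ((gu r - u r) / r) r)
    (dv : ∀ r ∈ Set.Ioo (0:ℝ) 1, HasDerivAt v ((gv r - v r) / r) r)
    (dgu : ∀ r ∈ Set.Ioo (0:ℝ) 1, HasDerivAt gu (r * lu r + gu r / r) r)
    (dgv : ∀ r ∈ Set.Ioo (0:ℝ) 1, HasDerivAt gv (r * lv r + gv r / r) r)
    (dlu : ∀ r ∈ Set.Ioo (0:ℝ) 1, HasDerivAt lu ((hu r - lu r) / r) r)
    (dlv : ∀ r ∈ Set.Ioo (0:ℝ) 1, HasDerivAt lv ((hv r - lv r) / r) r)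
    (dhu : ∀ r ∈ Set.Ioo (0:ℝ) 1, HasDerivAt hu (r * ku r + hu r / r) r)
    (dhv : ∀ r ∈ Set.Ioo (0:ℝ) 1, HasDerivAt hv (r * kv r + hv r / r) r)
    (cfu : ContinuousOn fu (Set.Ioo 0 1)) (cfv : ContinuousOn fv (Set.Ioo 0 1))
    (efu : ∀ r ∈ Set.Ioo (0:ℝ) 1, fu r = - n * U r * (lv r - n ^ 2 * v r)
      - (ku r - 2 * n ^ 2 * lu r + n ^ 4 * u r))
    (efv : ∀ r ∈ Set.Ioo (0:ℝ) 1, fv r = n * U r * (lu r - n ^ 2 * u r)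
      - (kv r - 2 * n ^ 2 * lv r + n ^ 4 * v r))
    (Ia : IntegrableOn (fun r => (u r ^ 2 + v r ^ 2) * r) (Set.Ioo 0 1))
    (Ib : IntegrableOn (fun r => (gu r ^ 2 + gv r ^ 2) / r) (Set.Ioo 0 1))
    (Ic : IntegrableOn (fun r => (lu r ^ 2 + lv r ^ 2) * r) (Set.Ioo 0 1))
    (If : IntegrableOn (fun r => (fu r ^ 2 + fv r ^ 2) * r) (Set.Ioo 0 1))
    (u0 : Tendsto u (nhdsWithin 0 (Set.Ioi 0)) (nhds 0))
    (v0 : Tendsto v (nhdsWithin 0 (Set.Ioi 0)) (nhds 0))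
    (gu0 : Tendsto gu (nhdsWithin 0 (Set.Ioi 0)) (nhds 0))
    (gv0 : Tendsto gv (nhdsWithin 0 (Set.Ioi 0)) (nhds 0))
    (lu0 : Tendsto lu (nhdsWithin 0 (Set.Ioi 0)) (nhds 0))
    (lv0 : Tendsto lv (nhdsWithin 0 (Set.Ioi 0)) (nhds 0))
    (thu0 : Tendsto hu (nhdsWithin 0 (Set.Ioi 0)) (nhds hu0))
    (thv0 : Tendsto hv (nhdsWithin 0 (Set.Ioi 0)) (nhds hv0))
    (u1 : Tendsto u (nhdsWithin 1 (Set.Iio 1)) (nhds 0))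
    (v1 : Tendsto v (nhdsWithin 1 (Set.Iio 1)) (nhds 0))
    (tgu1 : Tendsto gu (nhdsWithin 1 (Set.Iio 1)) (nhds gu1))
    (tgv1 : Tendsto gv (nhdsWithin 1 (Set.Iio 1)) (nhds gv1))
    (lu1 : Tendsto lu (nhdsWithin 1 (Set.Iio 1)) (nhds (-α * gu1)))
    (lv1 : Tendsto lv (nhdsWithin 1 (Set.Iio 1)) (nhds (-α * gv1)))
    (thu1 : Tendsto hu (nhdsWithin 1 (Set.Iio 1)) (nhds hu1))
    (thv1 : Tendsto hv (nhdsWithin 1 (Set.Iio 1)) (nhds hv1)) :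
    (4 * m * |n|) ^ 2 * (∫ r in Set.Ioo (0:ℝ) 1, (u r ^ 2 + v r ^ 2) * r)
      ≤ ∫ r in Set.Ioo (0:ℝ) 1, (fu r ^ 2 + fv r ^ 2) * r ∧
    (∫ r in Set.Ioo (0:ℝ) 1, (lu r ^ 2 + lv r ^ 2) * r)
      + n ^ 2 * (∫ r in Set.Ioo (0:ℝ) 1, (gu r ^ 2 + gv r ^ 2) / r)
      + n ^ 4 * (∫ r in Set.Ioo (0:ℝ) 1, (u r ^ 2 + v r ^ 2) * r)
      ≤ ∫ r in Set.Ioo (0:ℝ) 1, (fu r ^ 2 + fv r ^ 2) * r := by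
  have cu : ContinuousOn u (Set.Ioo 0 1) := fun r hr => (du r hr).continuousAt.continuousWithinAt
  have cv : ContinuousOn v (Set.Ioo 0 1) := fun r hr => (dv r hr).continuousAt.continuousWithinAt
  have cgu : ContinuousOn gu (Set.Ioo 0 1) := fun r hr => (dgu r hr).continuousAt.continuousWithinAt
  have cgv : ContinuousOn gv (Set.Ioo 0 1) := fun r hr => (dgv r hr).continuousAt.continuousWithinAt
  have clu : ContinuousOn lu (Set.Ioo 0 1) := fun r hr => (dlu r hr).continuousAt.continuousWithinAt
  have clv : ContinuousOn lv (Set.Ioo 0 1) := fun r hr => (dlv r hr).continuousAt.continuousWithinAt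
  have hne : ∀ r ∈ Set.Ioo (0:ℝ) 1, r ≠ 0 := fun r hr => hr.1.ne'
  have hUf : U = fun r => c - k / 2 * r ^ 2 := funext hU
  have dU : ∀ r, HasDerivAt U (- k * r) r := by
    intro r
    rw [hUf]
    have := ((hasDerivAt_pow 2 r).const_mul (k/2)).const_sub c
    exact this.congr_deriv (by push_cast; ring)
  have cU : Continuous U := by rw [hUf]; fun_prop
  have did : ∀ r : ℝ, HasDerivAt (fun r : ℝ => r) 1 r := fun r => hasDerivAt_id r
  have tid0 : Tendsto (fun r : ℝ => r) (nhdsWithin 0 (Set.Ioi 0)) (nhds 0) :=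
    tendsto_id.mono_left nhdsWithin_le_nhds
  have tid1 : Tendsto (fun r : ℝ => r) (nhdsWithin 1 (Set.Iio 1)) (nhds 1) :=
    tendsto_id.mono_left nhdsWithin_le_nhds
  have tU0 : Tendsto U (nhdsWithin 0 (Set.Ioi 0)) (nhds (U 0)) :=
    (cU.tendsto 0).mono_left nhdsWithin_le_nhds
  have tU1 : Tendsto U (nhdsWithin 1 (Set.Iio 1)) (nhds (U 1)) :=
    (cU.tendsto 1).mono_left nhdsWithin_le_nhds
  -- integrability
  have IUb : IntegrableOn (fun r => U r * ((gu r ^ 2 + gv r ^ 2) / r)) (Set.Ioo 0 1) := by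
    refine int_aux _ _ _ (|c| + k) (cU.continuousOn.mul (((cgu.pow 2).add (cgv.pow 2)).div continuousOn_id hne)) Ib Ib ?_
    intro r hr
    have h1 : 0 ≤ (gu r ^ 2 + gv r ^ 2) / r := div_nonneg (by positivity) hr.1.le
    have h2 : |U r| ≤ |c| + k := by
      rw [hU]
      refine (abs_sub _ _).trans ?_
      rw [abs_of_nonneg (by positivity : 0 ≤ k / 2 * r ^ 2)]
      nlinarith [hr.1, hr.2, mul_nonneg hk (show 0 ≤ 1 - r ^ 2 by nlinarith [hr.1, hr.2])]
    rw [abs_mul, abs_of_nonneg h1]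
    nlinarith [mul_le_mul_of_nonneg_right h2 h1, mul_nonneg (show 0 ≤ |c| + k by positivity) h1]
  have IUa : IntegrableOn (fun r => U r * ((u r ^ 2 + v r ^ 2) * r)) (Set.Ioo 0 1) := by
    refine int_aux _ _ _ (|c| + k) (cU.continuousOn.mul (((cu.pow 2).add (cv.pow 2)).mul continuousOn_id)) Ia Ia ?_
    intro r hr
    have h1 : 0 ≤ (u r ^ 2 + v r ^ 2) * r := mul_nonneg (by positivity) hr.1.le
    have h2 : |U r| ≤ |c| + k := by
      rw [hU]
      refine (abs_sub _ _).trans ?_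
      rw [abs_of_nonneg (by positivity : 0 ≤ k / 2 * r ^ 2)]
      nlinarith [hr.1, hr.2, mul_nonneg hk (show 0 ≤ 1 - r ^ 2 by nlinarith [hr.1, hr.2])]
    rw [abs_mul, abs_of_nonneg h1]
    nlinarith [mul_le_mul_of_nonneg_right h2 h1, mul_nonneg (show 0 ≤ |c| + k by positivity) h1]
  have Ifi : IntegrableOn (fun r => r * (fv r * u r - fu r * v r)) (Set.Ioo 0 1) := by
    refine int_aux _ _ _ 1 (continuousOn_id.mul ((cfv.mul cu).sub (cfu.mul cv))) If Ia ?_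
    intro r hr
    have h1 := mul_bd (fv r) (u r) r hr.1
    have h2 := mul_bd (fu r) (v r) r hr.1
    rw [abs_le] at *
    constructor <;> linarith
  have Ifr : IntegrableOn (fun r => r * (fu r * u r + fv r * v r)) (Set.Ioo 0 1) := by
    refine int_aux _ _ _ 1 (continuousOn_id.mul ((cfu.mul cu).add (cfv.mul cv))) If Ia ?_
    intro r hr
    have h1 := mul_bd (fu r) (u r) r hr.1
    have h2 := mul_bd (fv r) (v r) r hr.1
    rw [abs_le] at *
    constructor <;> linarith
  have Icr : IntegrableOn (fun r => r * (lu r * u r + lv r * v r)) (Set.Ioo 0 1) := by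
    refine int_aux _ _ _ 1 (continuousOn_id.mul ((clu.mul cu).add (clv.mul cv))) Ic Ia ?_
    intro r hr
    have h1 := mul_bd (lu r) (u r) r hr.1
    have h2 := mul_bd (lv r) (v r) r hr.1
    rw [abs_le] at *
    constructor <;> linarith
  have key : ∀ r ∈ Set.Ioo (0:ℝ) 1, ∀ t : ℝ, 0 ≤ t → ∀ x y : ℝ, |x * y| * t * 2 ≤
      x ^ 2 / r + t ^ 2 * y ^ 2 * r := by
    intro r hr t ht x y
    have hr0 := hr.1
    have : x ^ 2 / r + t ^ 2 * y ^ 2 * r - |x * y| * t * 2 = (|x| - t * |y| * r) ^ 2 / r := by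
      rw [abs_mul]
      field_simp
      have := sq_abs x
      have := sq_abs y
      linear_combination (-r * 0 - 1) * sq_abs x - t^2 * r^2 * sq_abs y
    have h2 : 0 ≤ (|x| - t * |y| * r) ^ 2 / r := by positivity
    linarith
  have Ibi : IntegrableOn (fun r => r * (gv r * u r - gu r * v r)) (Set.Ioo 0 1) := by
    refine int_aux _ _ _ 1 (continuousOn_id.mul ((cgv.mul cu).sub (cgu.mul cv))) Ib Ia ?_
    intro r hr
    have h1 := key r hr 1 zero_le_one (gv r) (u r)
    have h2 := key r hr 1 zero_le_one (gu r) (v r)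
    have h3 : |gv r * u r - gu r * v r| ≤ |gv r * u r| + |gu r * v r| := abs_sub _ _
    rw [abs_mul, abs_of_pos hr.1]
    have h4 := mul_le_mul_of_nonneg_left h3 hr.1.le
    have h5 := mul_nonneg (sub_nonneg.2 hr.2.le) (abs_nonneg (gv r * u r))
    have h6 := mul_nonneg (sub_nonneg.2 hr.2.le) (abs_nonneg (gu r * v r))
    rw [add_div]
    have h7 := abs_nonneg (gv r * u r)
    have h8 := abs_nonneg (gu r * v r)
    linarith
  have IHb : IntegrableOn (fun r => (1 - r ^ 2) * ((gu r ^ 2 + gv r ^ 2) / r)) (Set.Ioo 0 1) := by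
    refine int_aux _ _ _ 1 ((continuousOn_const.sub (continuousOn_id.pow 2)).mul (((cgu.pow 2).add (cgv.pow 2)).div continuousOn_id hne)) Ib Ib ?_
    intro r hr
    have h1 : 0 ≤ (gu r ^ 2 + gv r ^ 2) / r := div_nonneg (by positivity) hr.1.le
    have h3 : 0 ≤ 1 - r ^ 2 := by nlinarith [hr.1, hr.2]
    rw [abs_of_nonneg (mul_nonneg h3 h1)]
    nlinarith [mul_nonneg (sq_nonneg r) h1]
  -- (E) Hardy
  have E : 4 * (∫ r in Set.Ioo (0:ℝ) 1, (u r ^ 2 + v r ^ 2) * r) ≤ ∫ r in Set.Ioo (0:ℝ) 1, (1 - r ^ 2) * ((gu r ^ 2 + gv r ^ 2) / r) := by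
    have h := ftc_le_aux (fun r => (2 * (1 - r ^ 2)) * (u r ^ 2 + v r ^ 2))
      (fun r => (2 * (-(2 * r))) * (u r ^ 2 + v r ^ 2) + (2 * (1 - r ^ 2)) * (2 * u r * ((gu r - u r) / r) + 2 * v r * ((gv r - v r) / r)))
      (fun r => (1 - r ^ 2) * ((gu r ^ 2 + gv r ^ 2) / r) - 4 * ((u r ^ 2 + v r ^ 2) * r)) ?_ (IHb.sub (Ia.const_mul 4)) ?_ ?_ ?_
    · rw [integral_sub IHb (Ia.const_mul 4), integral_const_mul] at h
      linarith
    · intro r hr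
      refine HasDerivAt.congr_deriv (((((did r).pow 2).const_sub 1).const_mul 2).mul (((du r hr).pow 2).add ((dv r hr).pow 2))) ?_
      simp only [Pi.mul_apply, Pi.add_apply, Pi.pow_apply, Pi.sub_apply]
      push_cast
      ring
    · intro r hr
      have hr0 := hr.1
      have h3 : 0 ≤ 1 - r ^ 2 := by nlinarith [hr.1, hr.2]
      have h4 : 0 ≤ (1 - r ^ 2) * (((gu r - 2 * u r) ^ 2 + (gv r - 2 * v r) ^ 2) / r) := by positivity
      rw [← sub_nonneg]
      convert h4 using 1
      field_simp
      ring
    · have := ((tendsto_const_nhds (x := (1:ℝ))).sub (tid0.pow 2)).const_mul 2 |>.mul ((u0.pow 2).add (v0.pow 2))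
      simpa using this
    · have := ((tendsto_const_nhds (x := (1:ℝ))).sub (tid1.pow 2)).const_mul 2 |>.mul ((u1.pow 2).add (v1.pow 2))
      simpa using this
  have A : ∫ r in Set.Ioo (0:ℝ) 1, ((gu r ^ 2 + gv r ^ 2) / r + r * (lu r * u r + lv r * v r)) = 0 := by
    refine ftc_aux (fun r => gu r * u r + gv r * v r) _ _ ?_ (Ib.add Icr) ?_ ?_
    · intro r hr
      have := hr.1
      refine HasDerivAt.congr_deriv (((dgu r hr).mul (du r hr)).add ((dgv r hr).mul (dv r hr))) ?_
      field_simp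
      ring
    · simpa using (gu0.mul u0).add (gv0.mul v0)
    · simpa using (tgu1.mul u1).add (tgv1.mul v1)
  have R1 : ∫ r in Set.Ioo (0:ℝ) 1, (n * (U r * ((gu r ^ 2 + gv r ^ 2) / r)) + n ^ 3 * (U r * ((u r ^ 2 + v r ^ 2) * r)) + r * (fv r * u r - fu r * v r)) = 0 := by
    refine ftc_aux (fun r => -((hv r * u r - hu r * v r) - (lv r * gu r - lu r * gv r))
      + n * (U r * (gu r * u r + gv r * v r)) + n * k / 2 * (r ^ 2 * (u r ^ 2 + v r ^ 2))
      + 2 * n ^ 2 * (gv r * u r - gu r * v r)) _ _ ?_ (((IUb.const_mul n).add (IUa.const_mul (n^3))).add Ifi) ?_ ?_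
    · intro r hr
      have := hr.1
      refine HasDerivAt.congr_deriv (((((((dhv r hr).mul (du r hr)).sub ((dhu r hr).mul (dv r hr))).sub (((dlv r hr).mul (dgu r hr)).sub ((dlu r hr).mul (dgv r hr)))).neg.add
        (((dU r).mul (((dgu r hr).mul (du r hr)).add ((dgv r hr).mul (dv r hr)))).const_mul n)).add
        ((((did r).pow 2).mul (((du r hr).pow 2).add ((dv r hr).pow 2))).const_mul (n * k / 2))).add
        ((((dgv r hr).mul (du r hr)).sub ((dgu r hr).mul (dv r hr))).const_mul (2 * n ^ 2))) ?_
      rw [efu r hr, efv r hr]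
      simp only [Pi.mul_apply, Pi.add_apply, Pi.pow_apply, Pi.sub_apply]
      field_simp
      ring
    · have := ((((((thv0).mul (u0)).sub ((thu0).mul (v0))).sub (((lv0).mul (gu0)).sub ((lu0).mul (gv0)))).neg.add
        (((tU0).mul (((gu0).mul (u0)).add ((gv0).mul (v0)))).const_mul n)).add
        ((((tid0).pow 2).mul (((u0).pow 2).add ((v0).pow 2))).const_mul (n * k / 2))).add
        ((((gv0).mul (u0)).sub ((gu0).mul (v0))).const_mul (2 * n ^ 2))
      convert this using 2
      ring
    · have := ((((((thv1).mul (u1)).sub ((thu1).mul (v1))).sub (((lv1).mul (tgu1)).sub ((lu1).mul (tgv1)))).neg.add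
        (((tU1).mul (((tgu1).mul (u1)).add ((tgv1).mul (v1)))).const_mul n)).add
        ((((tid1).pow 2).mul (((u1).pow 2).add ((v1).pow 2))).const_mul (n * k / 2))).add
        ((((tgv1).mul (u1)).sub ((tgu1).mul (v1))).const_mul (2 * n ^ 2))
      convert this using 2
      ring
  have R2 : ∫ r in Set.Ioo (0:ℝ) 1, ((lu r ^ 2 + lv r ^ 2) * r + n ^ 4 * ((u r ^ 2 + v r ^ 2) * r)
      + 2 * n ^ 2 * ((gu r ^ 2 + gv r ^ 2) / r) + n * k * (r * (gv r * u r - gu r * v r))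
      + r * (fu r * u r + fv r * v r)) = - α * (gu1 ^ 2 + gv1 ^ 2) := by
    refine ftc_aux (fun r => -((hu r * u r + hv r * v r) - (lu r * gu r + lv r * gv r))
      - n * (U r * (gv r * u r - gu r * v r))
      + 2 * n ^ 2 * (gu r * u r + gv r * v r)) _ _ ?_ ((((Ic.add (Ia.const_mul (n^4))).add (Ib.const_mul (2 * n^2))).add (Ibi.const_mul (n * k))).add Ifr) ?_ ?_
    · intro r hr
      have := hr.1
      refine HasDerivAt.congr_deriv ((((((dhu r hr).mul (du r hr)).add ((dhv r hr).mul (dv r hr))).sub (((dlu r hr).mul (dgu r hr)).add ((dlv r hr).mul (dgv r hr)))).neg.sub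
        (((dU r).mul (((dgv r hr).mul (du r hr)).sub ((dgu r hr).mul (dv r hr)))).const_mul n)).add
        ((((dgu r hr).mul (du r hr)).add ((dgv r hr).mul (dv r hr))).const_mul (2 * n ^ 2))) ?_
      rw [efu r hr, efv r hr]
      simp only [Pi.mul_apply, Pi.add_apply, Pi.pow_apply, Pi.sub_apply]
      field_simp
      ring
    · have := (((((thu0).mul (u0)).add ((thv0).mul (v0))).sub (((lu0).mul (gu0)).add ((lv0).mul (gv0)))).neg.sub
        (((tU0).mul (((gv0).mul (u0)).sub ((gu0).mul (v0)))).const_mul n)).add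
        ((((gu0).mul (u0)).add ((gv0).mul (v0))).const_mul (2 * n ^ 2))
      convert this using 2
      ring
    · have := (((((thu1).mul (u1)).add ((thv1).mul (v1))).sub (((lu1).mul (tgu1)).add ((lv1).mul (tgv1)))).neg.sub
        (((tU1).mul (((tgv1).mul (u1)).sub ((tgu1).mul (v1)))).const_mul n)).add
        ((((tgu1).mul (u1)).add ((tgv1).mul (v1))).const_mul (2 * n ^ 2))
      convert this using 2
      ring
  set P := ∫ r in Set.Ioo (0:ℝ) 1, (u r ^ 2 + v r ^ 2) * r with hP
  set B := ∫ r in Set.Ioo (0:ℝ) 1, (gu r ^ 2 + gv r ^ 2) / r with hB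
  set X := ∫ r in Set.Ioo (0:ℝ) 1, (lu r ^ 2 + lv r ^ 2) * r with hX
  set F := ∫ r in Set.Ioo (0:ℝ) 1, (fu r ^ 2 + fv r ^ 2) * r with hF
  set J := ∫ r in Set.Ioo (0:ℝ) 1, (1 - r ^ 2) * ((gu r ^ 2 + gv r ^ 2) / r) with hJ
  have hP0 : 0 ≤ P := setIntegral_nonneg measurableSet_Ioo fun r hr =>
    mul_nonneg (by positivity) hr.1.le
  have hB0 : 0 ≤ B := setIntegral_nonneg measurableSet_Ioo fun r hr =>
    div_nonneg (by positivity) hr.1.le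
  have hX0 : 0 ≤ X := setIntegral_nonneg measurableSet_Ioo fun r hr =>
    mul_nonneg (by positivity) hr.1.le
  have hJB : J ≤ B := by
    refine setIntegral_mono_on IHb Ib measurableSet_Ioo fun r hr => ?_
    have h1 : 0 ≤ (gu r ^ 2 + gv r ^ 2) / r := div_nonneg (by positivity) hr.1.le
    nlinarith [mul_nonneg (sq_nonneg r) h1]
  have KP : HI _ P := ⟨Ia, rfl⟩
  have KB : HI _ B := ⟨Ib, rfl⟩
  have KX : HI _ X := ⟨Ic, rfl⟩
  have KF : HI _ F := ⟨If, rfl⟩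
  have KJ : HI _ J := ⟨IHb, rfl⟩
  have KA : HI _ 0 := ⟨Ib.add Icr, A⟩
  have KR1 : HI _ 0 := ⟨((IUb.const_mul n).add (IUa.const_mul (n^3))).add Ifi, R1⟩
  have KR2 : HI _ _ := ⟨(((Ic.add (Ia.const_mul (n^4))).add (Ib.const_mul (2 * n^2))).add (Ibi.const_mul (n * k))).add Ifr, R2⟩
  obtain ⟨σ, hσ, hσ2⟩ : ∃ σ : ℝ, σ * n = |n| ∧ |σ| = 1 := by
    rcases le_total 0 n with h | h
    · exact ⟨1, by rw [abs_of_nonneg h, one_mul], by simp⟩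
    · exact ⟨-1, by rw [abs_of_nonpos h]; ring, by simp⟩
  set N := |n| with hN
  have hN0 : 0 ≤ N := abs_nonneg n
  have hNn : N ^ 2 = n ^ 2 := sq_abs n
  set e := 4 * m * N with he
  have he0 : 0 ≤ e := by positivity
  have pw1 : ∀ r ∈ Set.Ioo (0:ℝ) 1, 2 * e * N * m * ((1 - r ^ 2) * ((gu r ^ 2 + gv r ^ 2) / r)) - e ^ 2 * ((u r ^ 2 + v r ^ 2) * r) - (fu r ^ 2 + fv r ^ 2) * r ≤ 2 * e * σ * (n * (U r * ((gu r ^ 2 + gv r ^ 2) / r)) + n ^ 3 * (U r * ((u r ^ 2 + v r ^ 2) * r)) + r * (fv r * u r - fu r * v r)) := by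
    intro r hr
    have hr0 := hr.1
    have hb : 0 ≤ (gu r ^ 2 + gv r ^ 2) / r := div_nonneg (by positivity) hr.1.le
    have ha : 0 ≤ (u r ^ 2 + v r ^ 2) * r := mul_nonneg (by positivity) hr.1.le
    have hUr := hUm r hr
    have h3 : 0 ≤ 1 - r ^ 2 := by nlinarith [hr.1, hr.2]
    have hU0 : 0 ≤ U r := le_trans (by positivity) hUr
    have hs2 : σ ^ 2 = 1 := by rw [← sq_abs, hσ2]; norm_num
    have t1 : 0 ≤ 2 * e * N * ((U r - m * (1 - r ^ 2)) * ((gu r ^ 2 + gv r ^ 2) / r)) := by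
      have := sub_nonneg.2 hUr
      positivity
    have t2 : 0 ≤ 2 * e * N * n ^ 2 * (U r * ((u r ^ 2 + v r ^ 2) * r)) := by positivity
    have t3 : 0 ≤ r * ((fv r + e * σ * u r) ^ 2 + (fu r - e * σ * v r) ^ 2) := by positivity
    have t4 : r * ((fv r + e * σ * u r) ^ 2 + (fu r - e * σ * v r) ^ 2)
        = (fu r ^ 2 + fv r ^ 2) * r + e ^ 2 * ((u r ^ 2 + v r ^ 2) * r) + 2 * e * σ * (r * (fv r * u r - fu r * v r)) := by
      linear_combination (r * e ^ 2 * (u r ^ 2 + v r ^ 2)) * hs2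
    have t5 : 2 * e * σ * (n * (U r * ((gu r ^ 2 + gv r ^ 2) / r)) + n ^ 3 * (U r * ((u r ^ 2 + v r ^ 2) * r)) + r * (fv r * u r - fu r * v r))
        = 2 * e * N * (U r * ((gu r ^ 2 + gv r ^ 2) / r)) + 2 * e * N * n ^ 2 * (U r * ((u r ^ 2 + v r ^ 2) * r))
          + 2 * e * σ * (r * (fv r * u r - fu r * v r)) := by
      rw [← hσ]; ring
    rw [t5]
    linarith
  have S1 : 2 * e * N * m * J - e ^ 2 * P - F ≤ 0 := by
    have hz : 2 * e * N * m * J - e ^ 2 * P - F ≤ 2 * e * σ * 0 := by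
      refine (((KJ.cmul (2 * e * N * m)).sub (KP.cmul (e ^ 2))).sub KF).mono (KR1.cmul (2 * e * σ)) fun r hr => ?_
      exact pw1 r hr
    simpa using hz
  have S1' : e ^ 2 * P ≤ F := by
    have : 2 * e * (N * m) * (4 * P) ≤ 2 * e * (N * m) * J := by gcongr
    have h2 : 2 * e * (N * m) * (4 * P) = 2 * e ^ 2 * P := by rw [he]; ring
    linarith
  have S2 : X + n ^ 4 * P + 2 * n ^ 2 * B - B - e ^ 2 / 4 * P - P - 1 / 4 * F ≤ 0 := by
    have h1 : - α * (gu1 ^ 2 + gv1 ^ 2) ≤ 0 := by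
      have : 0 ≤ α * (gu1 ^ 2 + gv1 ^ 2) := by positivity
      linarith
    refine le_trans ?_ h1
    refine ((((((KX.add (KP.cmul (n ^ 4))).add (KB.cmul (2 * n ^ 2))).sub KB).sub (KP.cmul (e ^ 2 / 4))).sub KP).sub
      (KF.cmul (1 / 4))).mono KR2 fun r hr => ?_
    simp only [Pi.add_apply]
    have hr0 := hr.1
    have t1 := key r hr (e / 2) (by positivity) (gv r) (u r)
    have t2 := key r hr (e / 2) (by positivity) (gu r) (v r)
    have t3 : 0 ≤ r * ((u r + fu r / 2) ^ 2 + (v r + fv r / 2) ^ 2) := by positivity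
    have t4 : |n * k * (r * (gv r * u r - gu r * v r))| ≤ e * (|gv r * u r| + |gu r * v r|) := by
      rw [abs_mul, abs_mul, abs_mul, abs_of_nonneg hk, abs_of_pos hr0]
      have q1 : |n| * k ≤ e := by rw [he, hN]; nlinarith [abs_nonneg n]
      have q2 : r * |gv r * u r - gu r * v r| ≤ |gv r * u r| + |gu r * v r| := by
        have := abs_sub (gv r * u r) (gu r * v r)
        nlinarith [abs_nonneg (gv r * u r - gu r * v r), hr.2]
      exact mul_le_mul q1 q2 (by positivity) he0
    have t5 := neg_abs_le (n * k * (r * (gv r * u r - gu r * v r)))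
    have t6 : (gu r ^ 2 + gv r ^ 2) / r = gu r ^ 2 / r + gv r ^ 2 / r := add_div _ _ _
    rw [t6]
    nlinarith
  have S3 : B - 1 / 8 * X - 2 * P ≤ 0 := by
    refine ((KB.sub (KX.cmul (1 / 8))).sub (KP.cmul 2)).mono KA fun r hr => ?_
    simp only [Pi.add_apply]
    have hr0 := hr.1
    have t3 : 0 ≤ r * ((lu r + 4 * u r) ^ 2 + (lv r + 4 * v r) ^ 2) := by positivity
    linarith
  refine ⟨S1', ?_⟩
  have z1 : 0 ≤ n ^ 2 * B := by positivity
  have z2 : 0 ≤ n ^ 4 * P := by positivity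
  have z3 : 0 ≤ F := le_trans (by positivity) S1'
  linarith

lemma wInt_aux (h h' : ℝ → ℝ) (he : ∀ r ∈ Set.Ioo (0:ℝ) 1, h r = h' r)
    (hc : ContinuousOn h' (Set.Ioo 0 1)) (h0 : ∀ r ∈ Set.Ioo (0:ℝ) 1, 0 ≤ h' r) (hf : wInt h < ⊤) :
    IntegrableOn h' (Set.Ioo 0 1) ∧ wInt h = ENNReal.ofReal (∫ r in Set.Ioo (0:ℝ) 1, h' r) := by
  have e : wInt h = ∫⁻ r in Set.Ioo (0 : ℝ) 1, ENNReal.ofReal (h' r) :=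
    setLIntegral_congr_fun measurableSet_Ioo fun r hr => by simp only [he r hr]
  have hn : 0 ≤ᵐ[volume.restrict (Set.Ioo (0:ℝ) 1)] h' := by
    filter_upwards [ae_restrict_mem measurableSet_Ioo] with r hr
    exact h0 r hr
  have hi : IntegrableOn h' (Set.Ioo 0 1) := by
    refine ⟨hc.aestronglyMeasurable measurableSet_Ioo, ?_⟩
    rw [hasFiniteIntegral_iff_ofReal hn, ← e]
    exact hf
  exact ⟨hi, by rw [e, ofReal_integral_eq_lintegral_ofReal hi hn]⟩

lemma norm_sq_aux (z : ℂ) : ‖z‖ ^ 2 = z.re ^ 2 + z.im ^ 2 := by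
  rw [Complex.sq_norm, Complex.normSq_apply]; ring

lemma dz_has (g : ℝ → ℂ) (hg : DifferentiableOn ℝ g (Set.Ioc 0 1)) (r : ℝ)
    (hr : r ∈ Set.Ioo (0:ℝ) 1) : HasDerivAt g (dz g r) r :=
  ((hg r ⟨hr.1, hr.2.le⟩).hasDerivWithinAt).hasDerivAt (Ioc_mem_nhds hr.1 hr.2)

lemma dz_mul (g : ℝ → ℂ) (hg : DifferentiableOn ℝ g (Set.Ioc 0 1)) (r : ℝ)
    (hr : r ∈ Set.Ioc (0:ℝ) 1) : dz (fun s => (s:ℂ) * g s) r = g r + r * dz g r := by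
  have h1 : HasDerivWithinAt (fun s : ℝ => (s:ℂ)) 1 (Set.Ioc 0 1) r :=
    (Complex.ofRealCLM.hasDerivAt (x := r)).hasDerivWithinAt
  have := (h1.mul (hg r hr).hasDerivWithinAt).derivWithin (uniqueDiffOn_Ioc 0 1 r hr)
  rw [one_mul] at this
  exact this

lemma dz_lin (a b : ℝ → ℂ) (c : ℂ) (ha : DifferentiableOn ℝ a (Set.Ioc 0 1))
    (hb : DifferentiableOn ℝ b (Set.Ioc 0 1)) (r : ℝ)
    (hr : r ∈ Set.Ioc (0:ℝ) 1) : dz (fun s => a s - c * b s) r = dz a r - c * dz b r :=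
  ((ha r hr).hasDerivWithinAt.sub ((hb r hr).hasDerivWithinAt.const_mul c)).derivWithin
    (uniqueDiffOn_Ioc 0 1 r hr)

lemma Lop_lin (a b : ℝ → ℂ) (c : ℂ) (ha : ContDiffOn ℝ 2 a (Set.Ioc 0 1))
    (hb : ContDiffOn ℝ 2 b (Set.Ioc 0 1)) (r : ℝ)
    (hr : r ∈ Set.Ioc (0:ℝ) 1) : Lop (fun s => a s - c * b s) r = Lop a r - c * Lop b r := by
  have ha1 : ContDiffOn ℝ 1 (dz a) (Set.Ioc 0 1) :=
    ha.derivWithin (uniqueDiffOn_Ioc 0 1) (by norm_num)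
  have hb1 : ContDiffOn ℝ 1 (dz b) (Set.Ioc 0 1) :=
    hb.derivWithin (uniqueDiffOn_Ioc 0 1) (by norm_num)
  have e1 := fun r hr => dz_lin a b c (ha.differentiableOn (by norm_num)) (hb.differentiableOn (by norm_num)) r hr
  have e2 : dz (dz (fun s => a s - c * b s)) r = dz (fun s => dz a s - c * dz b s) r :=
    derivWithin_congr e1 (e1 r hr)
  have e3 := dz_lin (dz a) (dz b) c (ha1.differentiableOn (by norm_num)) (hb1.differentiableOn (by norm_num)) r hr
  simp only [Lop]
  rw [e2, e3, e1 r hr]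
  ring

lemma G_has (g : ℝ → ℂ) (hg : ContDiffOn ℝ 2 g (Set.Ioc 0 1)) (r : ℝ)
    (hr : r ∈ Set.Ioo (0:ℝ) 1) : HasDerivAt (fun s : ℝ => g s + s * dz g s)
      (r * Lop g r + (g r + r * dz g r) / r) r := by
  have hg1 : ContDiffOn ℝ 1 (dz g) (Set.Ioc 0 1) :=
    hg.derivWithin (uniqueDiffOn_Ioc 0 1) (by norm_num)
  have h1 : HasDerivAt (fun s : ℝ => (s:ℂ)) 1 r := Complex.ofRealCLM.hasDerivAt (x := r)
  have h2 := dz_has g (hg.differentiableOn (by norm_num)) r hr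
  have h3 := dz_has (dz g) (hg1.differentiableOn (by norm_num)) r hr
  refine HasDerivAt.congr_deriv (h2.add (h1.mul h3)) ?_
  have : (r:ℂ) ≠ 0 := by exact_mod_cast hr.1.ne'
  simp only [Lop]
  field_simp
  ring

lemma has_re {g : ℝ → ℂ} {g' : ℂ} {r : ℝ} (h : HasDerivAt g g' r) :
    HasDerivAt (fun s => (g s).re) g'.re r := Complex.reCLM.hasFDerivAt.comp_hasDerivAt r h

lemma has_im {g : ℝ → ℂ} {g' : ℂ} {r : ℝ} (h : HasDerivAt g g' r) :
    HasDerivAt (fun s => (g s).im) g'.im r := Complex.imCLM.hasFDerivAt.comp_hasDerivAt r h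

lemma t_re {l : Filter ℝ} {g : ℝ → ℂ} {a : ℂ} (h : Tendsto g l (nhds a)) :
    Tendsto (fun s => (g s).re) l (nhds a.re) := (Complex.continuous_re.tendsto a).comp h

lemma t_im {l : Filter ℝ} {g : ℝ → ℂ} {a : ℂ} (h : Tendsto g l (nhds a)) :
    Tendsto (fun s => (g s).im) l (nhds a.im) := (Complex.continuous_im.tendsto a).comp h

lemma t_one {g : ℝ → ℂ} (h : ContinuousOn g (Set.Ioc 0 1)) :
    Tendsto g (nhdsWithin 1 (Set.Iio 1)) (nhds (g 1)) := by
  rw [← nhdsWithin_Ioo_eq_nhdsLT (zero_lt_one (α := ℝ))]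
  exact (h 1 ⟨zero_lt_one, le_rfl⟩).mono_left (nhdsWithin_mono _ Set.Ioo_subset_Ioc_self)

lemma wpack (w : ℝ → ℝ) (hw : ContinuousOn w (Set.Ioo 0 1)) (hw0 : ∀ r ∈ Set.Ioo (0:ℝ) 1, 0 ≤ w r)
    (h : ℝ → ℝ) (g : ℝ → ℂ) (hg : ContinuousOn g (Set.Ioo 0 1))
    (he : ∀ r ∈ Set.Ioo (0:ℝ) 1, h r = ‖g r‖ ^ 2 * w r) (hf : wInt h < ⊤) :
    IntegrableOn (fun r => ((g r).re ^ 2 + (g r).im ^ 2) * w r) (Set.Ioo 0 1) ∧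
    wInt h = ENNReal.ofReal (∫ r in Set.Ioo (0:ℝ) 1, ((g r).re ^ 2 + (g r).im ^ 2) * w r) := by
  refine wInt_aux h _ (fun r hr => by rw [he r hr, norm_sq_aux]) ?_ (fun r hr => ?_) hf
  · exact (((Complex.continuous_re.comp_continuousOn hg).pow 2).add
      ((Complex.continuous_im.comp_continuousOn hg).pow 2)).mul hw
  · exact mul_nonneg (by positivity) (hw0 r hr)

/-- Lemma B.1: a priori estimates of the stream function in terms of `f`,
uniform in `Φ ≥ 0`, `α ≥ 0` and `n`. -/
theorem stream_apriori_estimates :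
    ∃ C : ℝ, 0 < C ∧ ∀ (Φ α : ℝ) (n : ℤ) (f ψ : ℝ → ℂ),
      0 ≤ Φ → 0 ≤ α →
      ContinuousOn f (Set.Ioo 0 1) → wInt (fun r => ‖f r‖ ^ 2 * r) < ⊤ →
      NavierSol Φ α n f ψ →
      ENNReal.ofReal ((Φ * |(n : ℝ)|) ^ 2) * wInt (fun r => ‖ψ r‖ ^ 2 * r)
          ≤ ENNReal.ofReal C * wInt (fun r => ‖f r‖ ^ 2 * r) ∧
      wInt (fun r => ‖Lop ψ r‖ ^ 2 * r)
        + ENNReal.ofReal ((n : ℝ) ^ 2)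
            * wInt (fun r => ‖dz (fun s => (s : ℂ) * ψ s) r‖ ^ 2 / r)
        + ENNReal.ofReal ((n : ℝ) ^ 4) * wInt (fun r => ‖ψ r‖ ^ 2 * r)
          ≤ ENNReal.ofReal C * wInt (fun r => ‖f r‖ ^ 2 * r) := by
  refine ⟨1, one_pos, ?_⟩
  intro Φ α n f ψ hΦ hα cf ff hs
  have hsub : Set.Ioo (0:ℝ) 1 ⊆ Set.Ioc 0 1 := Set.Ioo_subset_Ioc_self
  have c0 := hs.smooth
  have c1 : ContDiffOn ℝ 3 (dz ψ) (Set.Ioc 0 1) :=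
    c0.derivWithin (uniqueDiffOn_Ioc 0 1) (by norm_num)
  have c2 : ContDiffOn ℝ 2 (dz (dz ψ)) (Set.Ioc 0 1) :=
    c1.derivWithin (uniqueDiffOn_Ioc 0 1) (by norm_num)
  have cofr : ContDiff ℝ 2 (fun r : ℝ => (r:ℂ)) := Complex.ofRealCLM.contDiff
  have cL : ContDiffOn ℝ 2 (Lop ψ) (Set.Ioc 0 1) := by
    have hne : ∀ r ∈ Set.Ioc (0:ℝ) 1, (r:ℂ) ≠ 0 := fun r hr => by exact_mod_cast hr.1.ne'
    exact (c2.add ((cofr.contDiffOn.inv hne).mul (c1.of_le (by norm_num)))).sub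
      (((cofr.pow 2).contDiffOn.inv (fun r hr => pow_ne_zero 2 (hne r hr))).mul (c0.of_le (by norm_num)))
  have cM : ContDiffOn ℝ 1 (dz (Lop ψ)) (Set.Ioc 0 1) :=
    cL.derivWithin (uniqueDiffOn_Ioc 0 1) (by norm_num)
  have c0' : ContDiffOn ℝ 2 ψ (Set.Ioc 0 1) := c0.of_le (by norm_num)
  have dψ : DifferentiableOn ℝ ψ (Set.Ioc 0 1) := c0.differentiableOn (by norm_num)
  have dL : DifferentiableOn ℝ (Lop ψ) (Set.Ioc 0 1) := cL.differentiableOn (by norm_num)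
  set G : ℝ → ℂ := fun r => ψ r + r * dz ψ r with hG
  set H : ℝ → ℂ := fun r => Lop ψ r + r * dz (Lop ψ) r with hH
  have cG : ContinuousOn G (Set.Ioc 0 1) :=
    c0.continuousOn.add (cofr.continuous.continuousOn.mul c1.continuousOn)
  have cH : ContinuousOn H (Set.Ioc 0 1) :=
    cL.continuousOn.add (cofr.continuous.continuousOn.mul cM.continuousOn)
  have hwr : ContinuousOn (fun r : ℝ => r) (Set.Ioo 0 1) := continuousOn_id
  have hwi : ContinuousOn (fun r : ℝ => r⁻¹) (Set.Ioo 0 1) :=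
    continuousOn_id.inv₀ fun r hr => hr.1.ne'
  obtain ⟨Ia, Wa⟩ := wpack _ hwr (fun r hr => hr.1.le) _ ψ (c0.continuousOn.mono hsub) (fun _ _ => rfl) hs.fin_psi
  obtain ⟨Ic, Wc⟩ := wpack _ hwr (fun r hr => hr.1.le) _ (Lop ψ) (cL.continuousOn.mono hsub) (fun _ _ => rfl) hs.fin_Lpsi
  obtain ⟨If, Wf⟩ := wpack _ hwr (fun r hr => hr.1.le) _ f cf (fun _ _ => rfl) ff
  obtain ⟨Ib, Wb⟩ := wpack _ hwi (fun r hr => (inv_pos.2 hr.1).le) _ G (cG.mono hsub)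
    (fun r hr => by rw [dz_mul ψ dψ r (hsub hr), div_eq_mul_inv]) hs.fin_dpsi
  have e0 : nhdsWithin (0:ℝ) (Set.Ioc 0 1) = nhdsWithin 0 (Set.Ioi 0) :=
    nhdsWithin_Ioc_eq_nhdsGT zero_lt_one
  have tψ := hs.ext_psi
  have tL := hs.ext_Lpsi
  obtain ⟨p0, tp⟩ := hs.ext_dpsi
  obtain ⟨h0, tH⟩ := hs.ext_dLpsi
  have tH' : Tendsto H (nhdsWithin (0:ℝ) (Set.Ioc 0 1)) (nhds h0) := by
    refine tH.congr' ?_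
    filter_upwards [self_mem_nhdsWithin] with r hr
    exact dz_mul _ dL r hr
  have tr : Tendsto (fun r : ℝ => (r:ℂ)) (nhdsWithin (0:ℝ) (Set.Ioc 0 1)) (nhds 0) := by
    have := (cofr.continuous.tendsto 0).mono_left (nhdsWithin_le_nhds (s := Set.Ioc 0 1))
    simpa using this
  have tG : Tendsto G (nhdsWithin (0:ℝ) (Set.Ioc 0 1)) (nhds 0) := by
    simpa using tψ.add (tr.mul tp)
  rw [e0] at tψ tL tH' tG
  have hG1 : G 1 = dz ψ 1 := by simp [hG, hs.bc_psi]
  have hL1 : Lop ψ 1 = -(α:ℂ) * G 1 := by rw [hG1, hs.bc_navier]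
  have oψ := t_one c0.continuousOn
  have oG := t_one cG
  have oL := t_one cL.continuousOn
  have oH := t_one cH
  rw [hs.bc_psi] at oψ
  rw [hL1] at oL
  have hdψ : ∀ r ∈ Set.Ioo (0:ℝ) 1, HasDerivAt ψ ((G r - ψ r) / r) r := by
    intro r hr
    have : (r:ℂ) ≠ 0 := by exact_mod_cast hr.1.ne'
    refine (dz_has ψ dψ r hr).congr_deriv ?_
    simp only [hG]; field_simp; ring
  have hdL : ∀ r ∈ Set.Ioo (0:ℝ) 1, HasDerivAt (Lop ψ) ((H r - Lop ψ r) / r) r := by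
    intro r hr
    have : (r:ℂ) ≠ 0 := by exact_mod_cast hr.1.ne'
    refine (dz_has _ dL r hr).congr_deriv ?_
    simp only [hH]; field_simp; ring
  have hdG : ∀ r ∈ Set.Ioo (0:ℝ) 1, HasDerivAt G (r * Lop ψ r + G r / r) r :=
    fun r hr => G_has ψ c0' r hr
  have hdH : ∀ r ∈ Set.Ioo (0:ℝ) 1, HasDerivAt H (r * Lop (Lop ψ) r + H r / r) r :=
    fun r hr => G_has (Lop ψ) cL r hr
  have heq : ∀ r ∈ Set.Ioo (0:ℝ) 1, f r = Complex.I * (n:ℂ) * (Ubar Φ α r : ℂ) * (Lop ψ r - (n : ℂ) ^ 2 * ψ r)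
      - (Lop (Lop ψ) r - 2 * (n:ℂ) ^ 2 * Lop ψ r + (n:ℂ) ^ 4 * ψ r) := by
    intro r hr
    rw [← hs.eqn r hr, Lop_lin (Lop ψ) ψ _ cL c0' r (hsub hr)]
    ring
  have hpi := Real.pi_pos
  have hα4 : 0 < 4 + α := by linarith
  have hα42 : 0 < 4 + 2 * α := by linarith
  have n2 : (n:ℂ) ^ 2 = (((n:ℝ) ^ 2 : ℝ) : ℂ) := by push_cast; rfl
  have n4 : (n:ℂ) ^ 4 = (((n:ℝ) ^ 4 : ℝ) : ℂ) := by push_cast; rfl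
  have n1 : (n:ℂ) = ((n:ℝ) : ℂ) := by push_cast; rfl
  have main := core (fun r => (ψ r).re) (fun r => (ψ r).im) (fun r => (G r).re) (fun r => (G r).im)
    (fun r => (Lop ψ r).re) (fun r => (Lop ψ r).im) (fun r => (H r).re) (fun r => (H r).im)
    (fun r => (Lop (Lop ψ) r).re) (fun r => (Lop (Lop ψ) r).im) (fun r => (f r).re) (fun r => (f r).im)
    (Ubar Φ α) n ((4 + 2 * α) / (4 + α) * (Φ / Real.pi)) (4 * α / (4 + α) * (Φ / Real.pi)) (Φ / Real.pi) α
    (G 1).re (G 1).im (H 1).re (H 1).im h0.re h0.im hα (by positivity) (by positivity)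
    (by
      have : α / (4 + α) ≤ 1 := by rw [div_le_one hα4]; linarith
      have h2 : 0 ≤ Φ / Real.pi := by positivity
      rw [mul_div_assoc]
      nlinarith)
    (by intro r; simp only [Ubar]; field_simp; ring)
    (by
      intro r hr
      have h2 : 0 ≤ Φ / Real.pi := by positivity
      have h3 : 1 - r ^ 2 ≤ (4 + 2 * α) / (4 + α) * (1 - 2 * α / (4 + 2 * α) * r ^ 2) := by
        have : (4 + 2 * α) / (4 + α) * (1 - 2 * α / (4 + 2 * α) * r ^ 2) = (4 + 2 * α - 2 * α * r ^ 2) / (4 + α) := by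
          field_simp
        rw [this, le_div_iff₀ hα4]
        nlinarith [mul_nonneg hα (show 0 ≤ 1 - r ^ 2 by nlinarith [hr.1, hr.2]), sq_nonneg r]
      simp only [Ubar]
      rw [mul_comm]
      exact mul_le_mul_of_nonneg_right h3 h2)
    (fun r hr => (has_re (hdψ r hr)).congr_deriv (by simp))
    (fun r hr => (has_im (hdψ r hr)).congr_deriv (by simp))
    (fun r hr => (has_re (hdG r hr)).congr_deriv (by simp))
    (fun r hr => (has_im (hdG r hr)).congr_deriv (by simp))
    (fun r hr => (has_re (hdL r hr)).congr_deriv (by simp))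
    (fun r hr => (has_im (hdL r hr)).congr_deriv (by simp))
    (fun r hr => (has_re (hdH r hr)).congr_deriv (by simp))
    (fun r hr => (has_im (hdH r hr)).congr_deriv (by simp))
    (Complex.continuous_re.comp_continuousOn cf) (Complex.continuous_im.comp_continuousOn cf)
    (by
      intro r hr
      simp only [heq r hr]
      rw [n2, n4, n1]
      simp [-Complex.ofReal_pow, -Complex.ofReal_intCast])
    (by
      intro r hr
      simp only [heq r hr]
      rw [n2, n4, n1]
      simp [-Complex.ofReal_pow, -Complex.ofReal_intCast])
    Ia (by simpa only [div_eq_mul_inv] using Ib) Ic If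
    (t_re tψ) (t_im tψ) (t_re tG) (t_im tG) (t_re tL) (t_im tL) (t_re tH') (t_im tH')
    (t_re oψ) (t_im oψ) (t_re oG) (t_im oG) (by simpa using t_re oL) (by simpa using t_im oL)
    (t_re oH) (t_im oH)
  obtain ⟨m1, m2⟩ := main
  simp only [div_eq_mul_inv] at m2
  rw [Wa, Wb, Wc, Wf]
  have hP0 : 0 ≤ ∫ r in Set.Ioo (0:ℝ) 1, ((ψ r).re ^ 2 + (ψ r).im ^ 2) * r :=
    setIntegral_nonneg measurableSet_Ioo fun r hr => mul_nonneg (by positivity) hr.1.le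
  have hX0 : 0 ≤ ∫ r in Set.Ioo (0:ℝ) 1, ((Lop ψ r).re ^ 2 + (Lop ψ r).im ^ 2) * r :=
    setIntegral_nonneg measurableSet_Ioo fun r hr => mul_nonneg (by positivity) hr.1.le
  have hB0 : 0 ≤ ∫ r in Set.Ioo (0:ℝ) 1, ((G r).re ^ 2 + (G r).im ^ 2) * r⁻¹ :=
    setIntegral_nonneg measurableSet_Ioo fun r hr => mul_nonneg (by positivity) (inv_pos.2 hr.1).le
  constructor
  · rw [← ENNReal.ofReal_mul (by positivity), ← ENNReal.ofReal_mul (by positivity), one_mul]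
    refine ENNReal.ofReal_le_ofReal (le_trans ?_ m1)
    refine mul_le_mul_of_nonneg_right ?_ hP0
    have : Φ ≤ 4 * (Φ / Real.pi) := by
      rw [← mul_div_assoc, le_div_iff₀ hpi]
      nlinarith [Real.pi_le_four]
    gcongr
  · rw [← ENNReal.ofReal_mul (by positivity), ← ENNReal.ofReal_mul (by positivity),
      ← ENNReal.ofReal_mul (by positivity), one_mul,
      ← ENNReal.ofReal_add hX0 (by positivity), ← ENNReal.ofReal_add (by positivity) (by positivity)]
    exact ENNReal.ofReal_le_ofReal m2
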